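/- (Truthful bidding is optimal for a price taker.) Let c : (0,∞) → ℝ be differentiable and strictly convex, with derivative c′ a strictly increasing continuous bijection from (0,∞) onto ℝ; let γ > 0, 0 < a ≤ b, and define the supply function s(π) := c′⁻¹(π)/γ. Then for every finite family of prices (π_s)_{s∈S} and weights p_s ≥ 0, the truthful bid α = γ maximizes α̂ ↦ Σ_{s∈S} p_s·(π_s·[α̂·s(π_s)]_a^b − c([α̂·s(π_s)]_a^b)) over α̂ ∈ (0,∞). -/

import Mathlib

open Finset

/-- Clamp `x` to the interval `[a,b]`: `[x]_a^b = min (max x a) b`. -/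
noncomputable def clamp (x a b : ℝ) : ℝ := min (max x a) b

theorem clamp_mem_Icc {a b : ℝ} (hab : a ≤ b) (x : ℝ) : clamp x a b ∈ Set.Icc a b :=
  ⟨le_min (le_max_right x a) hab, min_le_right _ _⟩

/-- A differentiable convex function lies above its tangent lines. -/
theorem ConvexOn.add_mul_sub_le_of_hasDerivAt {S : Set ℝ} {f : ℝ → ℝ} {f' x y : ℝ}
    (hf : ConvexOn ℝ S f) (hx : x ∈ S) (hy : y ∈ S) (hd : HasDerivAt f f' x) :
    f x + f' * (y - x) ≤ f y := by
  rcases lt_trichotomy x y with h | rfl | h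
  · have hs := hf.le_slope_of_hasDerivAt hx hy h hd
    rw [slope_def_field, le_div_iff₀ (sub_pos.2 h)] at hs
    linarith
  · simp
  · have hs := hf.slope_le_of_hasDerivAt hy hx h hd
    rw [slope_def_field, div_le_iff₀ (sub_pos.2 h)] at hs
    linarith

/-- The profit `π q - c q` on `[a, b]` is maximized by clamping the unconstrained critical
point `x`, where `c' x = π`. -/
theorem profit_le_profit_clamp {c c' : ℝ → ℝ}
    (hderiv : ∀ x ∈ Set.Ioi (0 : ℝ), HasDerivAt c (c' x) x)
    (hconv : ConvexOn ℝ (Set.Ioi 0) c) (hmono : MonotoneOn c' (Set.Ioi 0))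
    {a b x q : ℝ} (ha : 0 < a) (hab : a ≤ b) (hx : 0 < x) (hq : q ∈ Set.Icc a b) :
    c' x * q - c q ≤ c' x * clamp x a b - c (clamp x a b) := by
  have hz : 0 < clamp x a b := ha.trans_le (clamp_mem_Icc hab x).1
  have htan := hconv.add_mul_sub_le_of_hasDerivAt hz (ha.trans_le hq.1) (hderiv _ hz)
  suffices h : 0 ≤ (c' (clamp x a b) - c' x) * (q - clamp x a b) by linarith
  rcases le_total x a with hxa | hax
  · have hza : clamp x a b = a := by rw [clamp, max_eq_right hxa, min_eq_left hab]
    rw [hza]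
    exact mul_nonneg (sub_nonneg.2 (hmono hx ha hxa)) (sub_nonneg.2 hq.1)
  · rcases le_total x b with hxb | hbx
    · have hzx : clamp x a b = x := by rw [clamp, max_eq_left hax, min_eq_left hxb]
      simp [hzx]
    · have hzb : clamp x a b = b := by rw [clamp, max_eq_left hax, min_eq_right hbx]
      rw [hzb]
      exact mul_nonneg_of_nonpos_of_nonpos
        (sub_nonpos.2 (hmono (ha.trans_le hab) hx hbx)) (sub_nonpos.2 hq.2)

/-- **truthful bidding is optimal for a price taker.**
Let `c : (0,∞) → ℝ` be differentiable and strictly convex with derivative `c'`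
a strictly increasing continuous bijection from `(0,∞)` onto `ℝ` (with inverse
`cInv`), let `γ > 0` and `0 < a ≤ b`, and set `s(π) = cInv(π)/γ`. Then for any
finite family of prices `π_s` and nonnegative weights `p_s`, the truthful bid
`α̂ = γ` maximizes the expected profit
`α̂ ↦ ∑_s p_s (π_s·[α̂ s(π_s)]_a^b − c([α̂ s(π_s)]_a^b))` over `α̂ ∈ (0,∞)`. -/
theorem truthful_bidding_optimal
    (c c' cInv : ℝ → ℝ)
    (hderiv : ∀ x ∈ Set.Ioi (0 : ℝ), HasDerivAt c (c' x) x)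
    (hconv : StrictConvexOn ℝ (Set.Ioi 0) c)
    (hmono : StrictMonoOn c' (Set.Ioi 0))
    (hcont : ContinuousOn c' (Set.Ioi 0))
    (hInvMem : ∀ y : ℝ, cInv y ∈ Set.Ioi (0 : ℝ))
    (hInvR : ∀ y : ℝ, c' (cInv y) = y)
    (hInvL : ∀ x ∈ Set.Ioi (0 : ℝ), cInv (c' x) = x)
    (γ : ℝ) (hγ : 0 < γ)
    (a b : ℝ) (ha : 0 < a) (hab : a ≤ b)
    (S : Type) [Fintype S]
    (p : S → ℝ) (hp : ∀ s, 0 ≤ p s) (π : S → ℝ) :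
    ∀ α : ℝ, 0 < α →
      ∑ s, p s * (π s * clamp (α * (cInv (π s) / γ)) a b
                 - c (clamp (α * (cInv (π s) / γ)) a b)) ≤
      ∑ s, p s * (π s * clamp (γ * (cInv (π s) / γ)) a b
                 - c (clamp (γ * (cInv (π s) / γ)) a b)) := by
  intro α _
  refine Finset.sum_le_sum fun s _ => mul_le_mul_of_nonneg_left ?_ (hp s)
  rw [mul_div_cancel₀ (cInv (π s)) hγ.ne']
  have h := profit_le_profit_clamp hderiv hconv.convexOn hmono.monotoneOn ha hab
    (hInvMem (π s)) (clamp_mem_Icc hab (α * (cInv (π s) / γ)))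
  rwa [hInvR] at h
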